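/- If ξ_1, ξ_2 ∈ M_1^+(QC) (or both in M_{−1}^+(QC)) and their restrictions to the subalgebra Q̃C of even quasicontinuous functions coincide, then ξ_1 = ξ_2. -/

import Mathlib

open MeasureTheory Real Filter Topology

noncomputable section

/-- The `n`-th Fourier coefficient of `f : ℝ → ℂ` (representing `x ↦ f(e^{ix})`). -/
def fourierCoef (f : ℝ → ℂ) (n : ℤ) : ℂ :=
  (1 / (2 * π)) * ∫ x in (0 : ℝ)..(2 * π), f x * Complex.exp (-(Complex.I * n * x))

/-- `L^∞(T)`, modeled as bounded measurable `2π`-periodic functions `ℝ → ℂ`. -/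
def LinfT : Set (ℝ → ℂ) :=
  {f | Function.Periodic f (2 * π) ∧ Measurable f ∧ ∃ C, ∀ x, ‖f x‖ ≤ C}

/-- `C(T)`: continuous `2π`-periodic functions. -/
def CtsT : Set (ℝ → ℂ) := {f | Function.Periodic f (2 * π) ∧ Continuous f}

/-- The Hardy space `H^∞`: bounded functions whose negative Fourier coefficients vanish. -/
def HinfT : Set (ℝ → ℂ) := {f ∈ LinfT | ∀ n : ℤ, n < 0 → fourierCoef f n = 0}

/-- The conjugate Hardy space: bounded functions whose positive Fourier coefficients vanish. -/
def HinfBarT : Set (ℝ → ℂ) := {f ∈ LinfT | ∀ n : ℤ, 0 < n → fourierCoef f n = 0}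

/-- The quasicontinuous functions `QC = (C + H^∞) ∩ (C + conj(H^∞))`. -/
def QCset : Set (ℝ → ℂ) :=
  {f | (∃ c ∈ CtsT, ∃ h ∈ HinfT, f = c + h) ∧ (∃ c ∈ CtsT, ∃ h ∈ HinfBarT, f = c + h)}

/-- The flip `q̃(t) = q(1/t)`, i.e. `q̃(e^{ix}) = q(e^{-ix})`. -/
def flipF (f : ℝ → ℂ) : ℝ → ℂ := fun x => f (-x)

/-- The even quasicontinuous functions `Q̃C = {q ∈ QC : q = q̃}`. -/
def tQCset : Set (ℝ → ℂ) := {f ∈ QCset | flipF f = f}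

/-- The even continuous functions `C̃(T)`. -/
def evContT : Set (ℝ → ℂ) := {f ∈ CtsT | flipF f = f}

/-- The piecewise continuous functions `PC`: `2π`-periodic functions having one-sided
limits at every point. -/
def PCset : Set (ℝ → ℂ) :=
  {p | Function.Periodic p (2 * π) ∧
    ∀ θ : ℝ, (∃ l : ℂ, Tendsto p (𝓝[>] θ) (𝓝 l)) ∧ (∃ l : ℂ, Tendsto p (𝓝[<] θ) (𝓝 l))}

/-- `ξ` is a character (multiplicative linear functional of norm `1`) of the subalgebra of
`L^∞(T)` whose underlying set is `S`; only the values of `ξ` on `S` are relevant. -/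
def IsChar (S : Set (ℝ → ℂ)) (ξ : (ℝ → ℂ) → ℂ) : Prop :=
  (∀ p ∈ S, ∀ q ∈ S, ξ (p + q) = ξ p + ξ q) ∧
  (∀ p ∈ S, ∀ q ∈ S, ξ (p * q) = ξ p * ξ q) ∧
  (∀ (c : ℂ), ∀ q ∈ S, ξ (c • q) = c * ξ q) ∧
  ξ 1 = 1 ∧
  (∀ q ∈ S, ∀ C : ℝ, (∀ x, ‖q x‖ ≤ C) → ‖ξ q‖ ≤ C)

/-- The moving average `δ_{λ,τ}(a) = (λ/2π) ∫_{θ-π/λ}^{θ+π/λ} a(e^{ix}) dx`, `τ = e^{iθ}`. -/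
def movAvg (a : ℝ → ℂ) (lam θ : ℝ) : ℂ :=
  (lam / (2 * π)) * ∫ x in (θ - π / lam)..(θ + π / lam), a x

/-- `ξ ∈ M_τ^0(S)` (`τ = e^{iθ}`): `ξ` is a character of (the algebra with underlying set) `S`
lying in the weak-* closure of the moving-average functionals `{δ_{λ,τ} : λ ∈ [1,∞)}`. -/
def InM0 (S : Set (ℝ → ℂ)) (θ : ℝ) (ξ : (ℝ → ℂ) → ℂ) : Prop :=
  IsChar S ξ ∧
  ∀ qs : List (ℝ → ℂ), (∀ q ∈ qs, q ∈ S) → ∀ ε : ℝ, 0 < ε →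
    ∃ lam : ℝ, 1 ≤ lam ∧ ∀ q ∈ qs, ‖ξ q - movAvg q lam θ‖ < ε

/-- `ξ ∈ M_τ(S)` (`τ = e^{iθ}`): the fiber condition `ξ(f) = f(τ)` for all continuous `f`
belonging to `S`. -/
def InFiber (S : Set (ℝ → ℂ)) (θ : ℝ) (ξ : (ℝ → ℂ) → ℂ) : Prop :=
  IsChar S ξ ∧ ∀ f ∈ CtsT ∩ S, ξ f = f θ

/-- `ξ ∈ M_τ^+(QC)`: `ξ(f) = 0` whenever `limsup_{t→τ+0}|f(t)| = 0`, `f ∈ QC`. -/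
def InMplus (θ : ℝ) (ξ : (ℝ → ℂ) → ℂ) : Prop :=
  IsChar QCset ξ ∧
  ∀ f ∈ QCset, Filter.limsup (fun x => ‖f x‖) (𝓝[>] θ) = 0 → ξ f = 0

/-- `ξ ∈ M_τ^-(QC)`: `ξ(f) = 0` whenever `limsup_{t→τ-0}|f(t)| = 0`, `f ∈ QC`. -/
def InMminus (θ : ℝ) (ξ : (ℝ → ℂ) → ℂ) : Prop :=
  IsChar QCset ξ ∧
  ∀ f ∈ QCset, Filter.limsup (fun x => ‖f x‖) (𝓝[<] θ) = 0 → ξ f = 0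

/-- The conjugate character `ξ'(q) = ξ(q̃)`. -/
def conjChar (ξ : (ℝ → ℂ) → ℂ) : (ℝ → ℂ) → ℂ := fun q => ξ (flipF q)

/-- The circle variable `e^{ix}`. -/
def zz (x : ℝ) : ℂ := Complex.exp (Complex.I * x)

def Dk (r x : ℝ) : ℝ := 1 - 2 * r * Real.cos x + r ^ 2

/-- conjugate-type kernel -/
def Kk (r x : ℝ) : ℝ := Real.sin x / Dk r x

/-- Poisson kernel -/
def Pk (r x : ℝ) : ℝ := (1 - r ^ 2) / Dk r x

/-- Lebesgue measure on one period. -/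
def muT : Measure ℝ := volume.restrict (Set.Ioc 0 (2 * π))

/-- Lebesgue measure on `(-1,1)`. -/
def nuI : Measure ℝ := volume.restrict (Set.Ioo (-1) 1)

instance : IsFiniteMeasure muT := by unfold muT; infer_instance
instance : IsFiniteMeasure nuI := by unfold nuI; infer_instance

lemma zz_cont : Continuous zz := by unfold zz; fun_prop

lemma zz_norm (x : ℝ) : ‖zz x‖ = 1 := by
  unfold zz; rw [mul_comm]; exact Complex.norm_exp_ofReal_mul_I x

lemma zz_eq (x : ℝ) : zz x = Real.cos x + Real.sin x * Complex.I := by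
  unfold zz; rw [mul_comm, Complex.exp_mul_I]; simp

lemma zz_per : Function.Periodic zz (2 * π) := by
  intro x; rw [zz_eq, zz_eq, Real.cos_add_two_pi, Real.sin_add_two_pi]

lemma Dk_eq (r x : ℝ) : Dk r x = (r - Real.cos x) ^ 2 + Real.sin x ^ 2 := by
  unfold Dk; nlinarith [Real.sin_sq_add_cos_sq x]

lemma Dk_nonneg (r x : ℝ) : 0 ≤ Dk r x := by rw [Dk_eq]; positivity

lemma Dk_ge (r x : ℝ) : (1 - |r|) ^ 2 ≤ Dk r x := by
  unfold Dk
  have h1 : r * Real.cos x ≤ |r| := by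
    calc r * Real.cos x ≤ |r * Real.cos x| := le_abs_self _
      _ = |r| * |Real.cos x| := abs_mul _ _
      _ ≤ |r| * 1 := by gcongr; exact Real.abs_cos_le_one x
      _ = |r| := mul_one _
  nlinarith [sq_abs r]

lemma Dk_pos {r : ℝ} (hr : |r| < 1) (x : ℝ) : 0 < Dk r x :=
  lt_of_lt_of_le (by have : 0 < 1 - |r| := by linarith
                     positivity) (Dk_ge r x)

lemma one_sub_ne {r : ℝ} (hr : |r| < 1) (x : ℝ) : 1 - r * zz x ≠ 0 := by
  intro h
  have h2 : (r : ℂ) * zz x = 1 := by linear_combination -h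
  have := congrArg norm h2
  rw [norm_mul, zz_norm, Complex.norm_real] at this
  simp at this; linarith

lemma sub_ne {r : ℝ} (hr : |r| < 1) (x : ℝ) : zz x - r ≠ 0 := by
  intro h
  have h2 : (r : ℂ) = zz x := by linear_combination -h
  have := congrArg norm h2
  rw [zz_norm, Complex.norm_real] at this
  simp at this; linarith

lemma zz_ne (x : ℝ) : zz x ≠ 0 := by unfold zz; exact Complex.exp_ne_zero _

lemma cs_sq (x : ℝ) : (Real.sin x : ℂ) ^ 2 + (Real.cos x : ℂ) ^ 2 = 1 := by
  exact_mod_cast Real.sin_sq_add_cos_sq x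

lemma Dk_zz (r x : ℝ) : (Dk r x : ℂ) * zz x = (1 - r * zz x) * (zz x - r) := by
  have h := cs_sq x
  unfold Dk
  rw [zz_eq]; push_cast at h ⊢
  linear_combination (-r : ℂ) * h + (r * (Complex.sin x) ^ 2) * Complex.I_sq

lemma sin_zz (x : ℝ) : (Real.sin x : ℂ) * zz x * (2 * Complex.I) = zz x ^ 2 - 1 := by
  have h := cs_sq x
  rw [zz_eq]; push_cast at h ⊢
  linear_combination -h + ((Complex.sin x) ^ 2) * Complex.I_sq

lemma Kk_zz {r : ℝ} (hr : |r| < 1) (x : ℝ) :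
    (Kk r x : ℂ) = (zz x ^ 2 - 1) / (2 * Complex.I * (1 - r * zz x) * (zz x - r)) := by
  have h1 := one_sub_ne hr x
  have h2 := sub_ne hr x
  have h3 : (Dk r x : ℂ) ≠ 0 := by exact_mod_cast (Dk_pos hr x).ne'
  have h4 := zz_ne x
  unfold Kk
  push_cast
  rw [div_eq_div_iff h3 (by simp [h1, h2])]
  have h5 := Dk_zz r x
  have h6 := sin_zz x
  apply mul_right_cancel₀ h4
  push_cast at h5 h6 ⊢
  linear_combination (1 - r * zz x) * (zz x - r) * h6 - (zz x ^ 2 - 1) * h5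

lemma Pk_zz {r : ℝ} (hr : |r| < 1) (x : ℝ) :
    (Pk r x : ℂ) = (1 - r ^ 2) * zz x / ((1 - r * zz x) * (zz x - r)) := by
  have h3 : (Dk r x : ℂ) ≠ 0 := by exact_mod_cast (Dk_pos hr x).ne'
  have h4 := zz_ne x
  rw [← Dk_zz]
  unfold Pk
  push_cast
  field_simp

lemma bdd_integrable {μ : Measure ℝ} [IsFiniteMeasure μ] {f : ℝ → ℂ} (hf : Measurable f) {C : ℝ}
    (hC : ∀ x, ‖f x‖ ≤ C) : Integrable f μ :=
  Integrable.of_bound hf.aestronglyMeasurable C (Eventually.of_forall hC)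

lemma Gk_cont {r : ℝ} (hr : |r| < 1) (j : ℕ) :
    Continuous (fun x => zz x ^ j / (1 - r * zz x)) := by
  have := zz_cont
  exact (this.pow j).div (by fun_prop) (fun x => one_sub_ne hr x)

lemma Gk_bound {r : ℝ} (hr : |r| < 1) (j : ℕ) (x : ℝ) :
    ‖zz x ^ j / (1 - r * zz x)‖ ≤ 1 / (1 - |r|) := by
  rw [norm_div, norm_pow, zz_norm, one_pow]
  have h0 : 0 < 1 - |r| := by linarith
  have : 1 - |r| ≤ ‖1 - r * zz x‖ := by
    have := norm_sub_norm_le (1 : ℂ) (r * zz x)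
    rw [norm_mul, zz_norm, Complex.norm_real] at this
    simpa using this
  gcongr

lemma hG_int {h : ℝ → ℂ} (hm : Measurable h) {C : ℝ} (hC : ∀ x, ‖h x‖ ≤ C) {r : ℝ}
    (hr : |r| < 1) (j : ℕ) : Integrable (fun x => h x * (zz x ^ j / (1 - r * zz x))) muT := by
  have hC0 : 0 ≤ C := (norm_nonneg _).trans (hC 0)
  refine bdd_integrable (hm.mul (Gk_cont hr j).measurable) (C := C * (1 / (1 - |r|))) ?_
  intro x
  rw [norm_mul]
  exact mul_le_mul (hC x) (Gk_bound hr j x) (norm_nonneg _) hC0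

lemma lemA {h : ℝ → ℂ} (hm : Measurable h) {C : ℝ} (hC : ∀ x, ‖h x‖ ≤ C)
    (h0 : ∀ j : ℕ, ∫ x, h x * zz x ^ (j + 1) ∂muT = 0) {r : ℝ} (hr : |r| < 1) (j : ℕ) :
    ∫ x, h x * (zz x ^ (j + 1) / (1 - r * zz x)) ∂muT = 0 := by
  have hC0 : 0 ≤ C := (norm_nonneg _).trans (hC 0)
  set I : ℕ → ℂ := fun j => ∫ x, h x * (zz x ^ (j + 1) / (1 - r * zz x)) ∂muT with hI
  have step : ∀ j, I j = r * I (j + 1) := by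
    intro j
    have : I j - r * I (j + 1) = ∫ x, h x * zz x ^ (j + 1) ∂muT := by
      simp only [hI]
      rw [← integral_const_mul, ← integral_sub (hG_int hm hC hr _)
        ((hG_int hm hC hr _).const_mul _)]
      congr 1; ext x
      have := one_sub_ne hr x
      field_simp
      ring
    rw [h0] at this
    linear_combination this
  have iter : ∀ k, I j = r ^ k * I (j + k) := by
    intro k
    induction k with
    | zero => simp
    | succ k ih => rw [ih, step (j + k), pow_succ, ← add_assoc]; ring
  obtain ⟨M, hM⟩ : ∃ M, ∀ j, ‖I j‖ ≤ M := by
    refine ⟨C * (1 / (1 - |r|)) * muT.real Set.univ, fun j => ?_⟩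
    refine norm_integral_le_of_norm_le_const (Eventually.of_forall fun x => ?_)
    rw [norm_mul]
    exact mul_le_mul (hC x) (Gk_bound hr _ x) (norm_nonneg _) hC0
  have lim : Tendsto (fun k : ℕ => |r| ^ k * M) atTop (𝓝 0) := by
    simpa using (tendsto_pow_atTop_nhds_zero_of_lt_one (abs_nonneg r) hr).mul_const M
  have : ‖I j‖ ≤ 0 := by
    refine ge_of_tendsto' lim fun k => ?_
    rw [iter k, norm_mul, norm_pow, Complex.norm_real, Real.norm_eq_abs]
    gcongr
    exact hM _
  exact norm_le_zero_iff.mp this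

lemma Dk_cont (r : ℝ) : Continuous (Dk r) := by unfold Dk; fun_prop

lemma Kk_cont {r : ℝ} (hr : |r| < 1) : Continuous (Kk r) :=
  Real.continuous_sin.div (Dk_cont r) fun x => (Dk_pos hr x).ne'

lemma Pk_cont {r : ℝ} (hr : |r| < 1) : Continuous (Pk r) :=
  continuous_const.div (Dk_cont r) fun x => (Dk_pos hr x).ne'

lemma Kk_bound {r : ℝ} (hr : |r| < 1) (x : ℝ) : |Kk r x| ≤ 1 / (1 - |r|) ^ 2 := by
  have : 0 < 1 - |r| := by linarith
  unfold Kk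
  rw [abs_div, abs_of_nonneg (Dk_nonneg r x)]
  exact div_le_div₀ zero_le_one (Real.abs_sin_le_one x) (by positivity) (Dk_ge r x)

lemma Pk_nonneg {r : ℝ} (hr : |r| < 1) (x : ℝ) : 0 ≤ Pk r x := by
  have : r ^ 2 ≤ 1 := by rw [← sq_abs]; nlinarith [abs_nonneg r]
  exact div_nonneg (by linarith) (Dk_nonneg r x)

lemma Pk_bound {r : ℝ} (hr : |r| < 1) (x : ℝ) : |Pk r x| ≤ 1 / (1 - |r|) ^ 2 := by
  have : 0 < 1 - |r| := by linarith
  unfold Pk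
  have h2 : r ^ 2 ≤ 1 := by rw [← sq_abs]; nlinarith [abs_nonneg r]
  rw [abs_div, abs_of_nonneg (Dk_nonneg r x), abs_of_nonneg (by linarith)]
  exact div_le_div₀ zero_le_one (by nlinarith [sq_nonneg r]) (by positivity) (Dk_ge r x)

lemma mul_int {h : ℝ → ℂ} (hm : Measurable h) {C : ℝ} (hC : ∀ x, ‖h x‖ ≤ C) {g : ℝ → ℂ}
    (gm : Measurable g) {B : ℝ} (hB : ∀ x, ‖g x‖ ≤ B) {μ : Measure ℝ} [IsFiniteMeasure μ] :
    Integrable (fun x => h x * g x) μ := by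
  have hC0 : 0 ≤ C := (norm_nonneg _).trans (hC 0)
  refine bdd_integrable (hm.mul gm) (C := C * B) ?_
  intro x
  rw [norm_mul]
  exact mul_le_mul (hC x) (hB x) (norm_nonneg _) hC0

/-- Key identity. -/
lemma key_id {h : ℝ → ℂ} (hm : Measurable h) {C : ℝ} (hC : ∀ x, ‖h x‖ ≤ C)
    (h0 : ∀ j : ℕ, ∫ x, h x * zz x ^ (j + 1) ∂muT = 0) {r : ℝ} (hr : |r| < 1) (n : ℕ) :
    ∫ x, h x * (zz x ^ (n + 1) * Kk r x) ∂muT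
      = Complex.I / 2 * r ^ n * ∫ x, h x * (Pk r x : ℂ) ∂muT := by
  have hKi : ∀ n : ℕ, Integrable (fun x => h x * (zz x ^ n * Kk r x)) muT := by
    intro n
    refine mul_int hm hC (B := 1 / (1 - |r|) ^ 2) ?_ ?_
    · exact ((zz_cont.pow n).mul (Complex.continuous_ofReal.comp (Kk_cont hr))).measurable
    · intro x
      rw [norm_mul, norm_pow, zz_norm, one_pow, one_mul, Complex.norm_real]
      exact Kk_bound hr x
  have hPi : Integrable (fun x => h x * (Pk r x : ℂ)) muT := by
    refine mul_int hm hC (B := 1 / (1 - |r|) ^ 2) ?_ ?_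
    · exact (Complex.continuous_ofReal.comp (Pk_cont hr)).measurable
    · intro x
      rw [Complex.norm_real]
      exact Pk_bound hr x
  have A := lemA hm hC h0 hr
  induction n with
  | zero =>
    have e : ∫ x, (h x * (zz x ^ (0 + 1) * Kk r x) - Complex.I / 2 * (h x * (Pk r x : ℂ))) ∂muT
        = ∫ x, (1 / (2 * Complex.I) * (h x * (zz x ^ (1 + 1) / (1 - r * zz x)))
          + r / (2 * Complex.I) * (h x * (zz x ^ (0 + 1) / (1 - r * zz x)))) ∂muT := by
      congr 1; ext x
      rw [Kk_zz hr, Pk_zz hr]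
      have h1 := one_sub_ne hr x
      have h2 := sub_ne hr x
      have h3 := Complex.I_ne_zero
      field_simp
      rw [Complex.I_sq]
      ring
    rw [integral_sub (hKi _) (hPi.const_mul _), integral_add ((hG_int hm hC hr _).const_mul _)
      ((hG_int hm hC hr _).const_mul _)] at e
    simp only [integral_const_mul, A] at e
    linear_combination e
  | succ n ih =>
    have e : ∫ x, (h x * (zz x ^ (n + 1 + 1) * Kk r x) - r * (h x * (zz x ^ (n + 1) * Kk r x))) ∂muT
        = ∫ x, (1 / (2 * Complex.I) * (h x * (zz x ^ (n + 2 + 1) / (1 - r * zz x)))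
          - 1 / (2 * Complex.I) * (h x * (zz x ^ (n + 1) / (1 - r * zz x)))) ∂muT := by
      congr 1; ext x
      rw [Kk_zz hr]
      have h1 := one_sub_ne hr x
      have h2 := sub_ne hr x
      have h3 := Complex.I_ne_zero
      field_simp
      ring
    rw [integral_sub (hKi _) ((hKi _).const_mul _), integral_sub ((hG_int hm hC hr _).const_mul _)
      ((hG_int hm hC hr _).const_mul _)] at e
    simp only [integral_const_mul, A, ih] at e
    rw [pow_succ]
    linear_combination e

lemma int_zz_pow (j : ℕ) : ∫ x, (1 : ℂ) * zz x ^ (j + 1) ∂muT = 0 := by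
  unfold muT
  rw [← intervalIntegral.integral_of_le (by positivity)]
  have hne : ((j + 1 : ℕ) : ℂ) * Complex.I ≠ 0 :=
    mul_ne_zero (by exact_mod_cast Nat.succ_ne_zero j) Complex.I_ne_zero
  have : ∀ x : ℝ, (1 : ℂ) * zz x ^ (j + 1) = Complex.exp (((j + 1 : ℕ) : ℂ) * Complex.I * x) := by
    intro x; unfold zz; rw [one_mul, ← Complex.exp_nat_mul]; congr 1; ring
  simp_rw [this]
  rw [integral_exp_mul_complex hne]
  have : Complex.exp (((j + 1 : ℕ) : ℂ) * Complex.I * ((2 * π : ℝ) : ℂ)) = 1 := by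
    rw [Complex.exp_eq_one_iff]; exact ⟨(j + 1 : ℕ), by push_cast; ring⟩
  rw [this]; simp

lemma int_Pk {r : ℝ} (hr : |r| < 1) : ∫ x, Pk r x ∂muT = 2 * π := by
  have A := lemA (h := fun _ => 1) measurable_const (C := 1) (by simp) int_zz_pow hr 0
  have Ai := hG_int (h := fun _ => 1) measurable_const (C := 1) (by simp) hr (0 + 1)
  set G : ℝ → ℂ := fun x => 1 * (zz x ^ (0 + 1) / (1 - r * zz x)) with hG
  have hP : ∀ x, Pk r x = 1 + 2 * r * (G x).re := by
    intro x
    have hb := one_sub_ne hr x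
    have hc := (Dk_pos hr x).ne'
    have e : G x = ((Real.cos x - r : ℝ) + (Real.sin x : ℝ) * Complex.I) / (Dk r x : ℝ) := by
      simp only [hG]
      rw [one_mul, div_eq_div_iff hb (by exact_mod_cast hc), zero_add, pow_one, mul_comm, Dk_zz, mul_comm]
      rw [zz_eq]; push_cast; ring
    rw [e, Complex.div_ofReal_re]
    simp only [Complex.add_re, Complex.ofReal_re, Complex.mul_re, Complex.I_re, Complex.I_im,
      Complex.ofReal_im]
    unfold Pk
    field_simp
    unfold Dk; ring
  simp_rw [hP]
  have hre : ∫ x, (G x).re ∂muT = 0 := by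
    have := integral_re Ai
    simp only [RCLike.re_to_complex] at this
    rw [this, A]; simp
  have hri : Integrable (fun x => (G x).re) muT := Ai.re
  rw [integral_add (integrable_const _) (hri.const_mul _), integral_const_mul, hre]
  simp [muT, Real.pi_pos.le]

/-- the sign function on the circle: `1` on the upper and `-1` on the lower half. -/
def sg (x : ℝ) : ℝ := Real.sign (Real.sin x)

lemma Kk_meas : Measurable (Function.uncurry Kk) := by
  unfold Function.uncurry Kk Dk; fun_prop

lemma Kk_meas_r (x : ℝ) : Measurable (fun r => (Kk r x : ℂ)) := by
  unfold Kk Dk; fun_prop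

lemma Kk_meas_p : Measurable (fun p : ℝ × ℝ => (Kk p.2 p.1 : ℂ)) := by
  unfold Kk Dk; fun_prop

lemma Kk_neg (r x : ℝ) : Kk r (-x) = - Kk r x := by
  unfold Kk Dk; rw [Real.sin_neg, Real.cos_neg, neg_div]

lemma sg_neg (x : ℝ) : sg (-x) = - sg x := by
  unfold sg; rw [Real.sin_neg, Real.sign_neg]

lemma sg_abs (x : ℝ) : |sg x| ≤ 1 := by
  unfold sg
  rcases Real.sign_apply_eq (Real.sin x) with h | h | h <;> rw [h] <;> norm_num

lemma Kk_abs (r x : ℝ) : |Kk r x| = sg x * Kk r x := by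
  have hD := Dk_nonneg r x
  unfold sg Kk
  rcases lt_trichotomy (Real.sin x) 0 with h | h | h
  · rw [Real.sign_of_neg h, abs_of_nonpos (div_nonpos_of_nonpos_of_nonneg h.le hD)]; ring
  · simp [h]
  · rw [Real.sign_of_pos h, abs_of_nonneg (div_nonneg h.le hD)]; ring

lemma Kk_r_pos {x : ℝ} (hx : 0 < Real.sin x) :
    Integrable (fun r => Kk r x) nuI ∧ ∫ r, Kk r x ∂nuI = π / 2 := by
  have hDp : ∀ r, 0 < Dk r x := fun r => by rw [Dk_eq]; positivity
  have hc : Continuous (fun r => Kk r x) := by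
    refine continuous_const.div ?_ fun r => (hDp r).ne'
    unfold Dk; fun_prop
  have hder : ∀ r : ℝ, HasDerivAt (fun r => Real.arctan ((r - Real.cos x) / Real.sin x)) (Kk r x) r := by
    intro r
    have h1 : HasDerivAt (fun r : ℝ => (r - Real.cos x) / Real.sin x) (1 / Real.sin x) r :=
      ((hasDerivAt_id r).sub_const _).div_const _
    convert h1.arctan using 1
    unfold Kk
    have := (hDp r).ne'
    rw [Dk_eq] at this ⊢
    have h3 := hx.ne'
    have h4 : 1 + ((r - Real.cos x) / Real.sin x) ^ 2 ≠ 0 := by positivity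
    field_simp
    ring
  have hI : IntervalIntegrable (fun r => Kk r x) volume (-1) 1 := hc.intervalIntegrable _ _
  constructor
  · have := hI.1
    exact IntegrableOn.mono_set this Set.Ioo_subset_Ioc_self
  · unfold nuI
    rw [← integral_Ioc_eq_integral_Ioo, ← intervalIntegral.integral_of_le (by norm_num),
      intervalIntegral.integral_eq_sub_of_hasDerivAt (fun r _ => hder r) hI]
    have hcos : Real.cos x < 1 := by
      nlinarith [Real.sin_sq_add_cos_sq x, Real.cos_le_one x]
    have ha : 0 < (1 - Real.cos x) / Real.sin x := div_pos (by linarith) hx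
    have e : (-1 - Real.cos x) / Real.sin x = - ((1 - Real.cos x) / Real.sin x)⁻¹ := by
      have : 1 - Real.cos x ≠ 0 := by linarith
      rw [inv_div]
      field_simp
      nlinarith [Real.sin_sq_add_cos_sq x]
    rw [e, Real.arctan_neg, Real.arctan_inv_of_pos ha]
    ring

lemma Kk_r (x : ℝ) :
    Integrable (fun r => Kk r x) nuI ∧ ∫ r, Kk r x ∂nuI = π / 2 * sg x := by
  rcases lt_trichotomy (Real.sin x) 0 with h | h | h
  · have h2 : 0 < Real.sin (-x) := by rw [Real.sin_neg]; linarith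
    obtain ⟨a, b⟩ := Kk_r_pos h2
    simp only [Kk_neg] at a b
    rw [integral_neg] at b
    refine ⟨by simpa using a.neg, ?_⟩
    unfold sg
    rw [Real.sign_of_neg h]; linarith
  · simp [Kk, sg, h]
  · have := Kk_r_pos h
    unfold sg
    rwa [Real.sign_of_pos h, mul_one]

lemma Kk_abs_int (x : ℝ) : ∫ r, |Kk r x| ∂nuI ≤ π / 2 := by
  simp_rw [Kk_abs]
  rw [integral_const_mul, (Kk_r x).2]
  have : sg x * sg x ≤ 1 := by
    have := sg_abs x
    rw [← abs_mul_abs_self]; nlinarith [abs_nonneg (sg x)]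
  nlinarith [Real.pi_pos]

/-- The operator `ψ ↦ (2/π) ∫ ψ(r) K_r(x) dr`. -/
def TT (ψ : ℝ → ℂ) (x : ℝ) : ℂ := ∫ r, ψ r * (Kk r x : ℂ) ∂nuI

lemma nuI_ae : ∀ᵐ r ∂nuI, |r| < 1 := by
  unfold nuI
  filter_upwards [ae_restrict_mem measurableSet_Ioo] with r hr
  exact abs_lt.mpr hr

lemma TT_int {ψ : ℝ → ℂ} (hm : Measurable ψ) {M : ℝ} (hM : ∀ r, |r| < 1 → ‖ψ r‖ ≤ M) (x : ℝ) :
    Integrable (fun r => ψ r * (Kk r x : ℂ)) nuI := by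
  have := (Kk_r x).1.ofReal (𝕜 := ℂ)
  refine this.bdd_mul (c := M) hm.aestronglyMeasurable ?_
  filter_upwards [nuI_ae] with r hr using hM r hr

lemma TT_bound {ψ : ℝ → ℂ} {M : ℝ} (hM : ∀ r, |r| < 1 → ‖ψ r‖ ≤ M)
    (x : ℝ) : ‖TT ψ x‖ ≤ M * (π / 2) := by
  have hM0 : 0 ≤ M := (norm_nonneg _).trans (hM 0 (by simp))
  unfold TT
  calc ‖∫ r, ψ r * (Kk r x : ℂ) ∂nuI‖ ≤ ∫ r, M * |Kk r x| ∂nuI := by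
        refine norm_integral_le_of_norm_le ((Kk_r x).1.abs.const_mul M) ?_
        filter_upwards [nuI_ae] with r hr
        rw [norm_mul, Complex.norm_real, Real.norm_eq_abs]
        gcongr
        exact hM r hr
    _ ≤ M * (π / 2) := by
        rw [integral_const_mul]
        gcongr
        exact Kk_abs_int x

lemma TT_cont_aux {ψ : ℝ → ℂ} (hm : Measurable ψ) {M : ℝ} (hM : ∀ r, |r| < 1 → ‖ψ r‖ ≤ M)
    {ρ : ℝ} (hρ : ρ < 1) : Continuous (TT (fun r => if |r| ≤ ρ then ψ r else 0)) := by
  have hM0 : 0 ≤ M := (norm_nonneg _).trans (hM 0 (by simp))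
  unfold TT
  have hme : Measurable (fun r => if |r| ≤ ρ then ψ r else 0) :=
    Measurable.ite (measurableSet_le (by fun_prop) measurable_const) hm measurable_const
  refine continuous_of_dominated (bound := fun _ => M * (1 / (1 - ρ) ^ 2)) ?_ ?_
    (integrable_const _) ?_
  · intro x
    exact (hme.mul (Kk_meas_r x)).aestronglyMeasurable
  · intro x
    filter_upwards [nuI_ae] with r hr
    have h1 : 0 < 1 - ρ := by linarith
    split_ifs with h
    · rw [norm_mul, Complex.norm_real, Real.norm_eq_abs]
      refine mul_le_mul (hM r hr) ((Kk_bound hr x).trans ?_) (abs_nonneg _) hM0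
      gcongr
    · rw [zero_mul, norm_zero]; positivity
  · filter_upwards [nuI_ae] with r hr
    exact continuous_const.mul (Complex.continuous_ofReal.comp (Kk_cont hr))

lemma TT_cont {ψ : ℝ → ℂ} (hm : Measurable ψ) {M : ℝ} (hM : ∀ r, |r| < 1 → ‖ψ r‖ ≤ M)
    (hv : ∀ ε > 0, ∃ ρ < 1, ∀ r, ρ < |r| → |r| < 1 → ‖ψ r‖ ≤ ε) : Continuous (TT ψ) := by
  have hM0 : 0 ≤ M := (norm_nonneg _).trans (hM 0 (by simp))
  refine continuous_of_uniform_approx_of_continuous fun u hu => ?_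
  obtain ⟨ε, hε, hu⟩ := Metric.mem_uniformity_dist.mp hu
  obtain ⟨ρ, hρ, hψ⟩ := hv (ε / 4) (by positivity)
  refine ⟨_, TT_cont_aux hm hM hρ, fun x => hu ?_⟩
  have hme : Measurable (fun r => if |r| ≤ ρ then ψ r else 0) :=
    Measurable.ite (measurableSet_le (by fun_prop) measurable_const) hm measurable_const
  have hM2 : ∀ r, |r| < 1 → ‖(if |r| ≤ ρ then ψ r else 0)‖ ≤ M := by
    intro r hr
    split_ifs
    · exact hM r hr
    · simpa using hM0
  have e : TT ψ x - TT (fun r => if |r| ≤ ρ then ψ r else 0) x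
      = TT (fun r => ψ r - (if |r| ≤ ρ then ψ r else 0)) x := by
    unfold TT
    rw [← integral_sub (TT_int hm hM x) (TT_int hme hM2 x)]
    congr 1; ext r; ring
  rw [dist_eq_norm, e]
  refine (TT_bound (M := ε / 4) ?_ x).trans_lt ?_
  · intro r hr
    split_ifs with h
    · rw [sub_self, norm_zero]; positivity
    · rw [sub_zero]; exact hψ r (not_le.mp h) hr
  · nlinarith [Real.pi_lt_four]

lemma fubini {ψ : ℝ → ℂ} (hm : Measurable ψ) {M : ℝ} (hM : ∀ r, |r| < 1 → ‖ψ r‖ ≤ M)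
    {g : ℝ → ℂ} (gm : Measurable g) {C : ℝ} (hC : ∀ x, ‖g x‖ ≤ C) :
    ∫ x, g x * TT ψ x ∂muT = ∫ r, ψ r * ∫ x, g x * (Kk r x : ℂ) ∂muT ∂nuI := by
  have hM0 : 0 ≤ M := (norm_nonneg _).trans (hM 0 (by simp))
  have hC0 : 0 ≤ C := (norm_nonneg _).trans (hC 0)
  have hmeas : Measurable (fun p : ℝ × ℝ => g p.1 * (ψ p.2 * (Kk p.2 p.1 : ℂ))) := by
    refine (gm.comp measurable_fst).mul ((hm.comp measurable_snd).mul Kk_meas_p)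
  have hint : Integrable (Function.uncurry fun x r => g x * (ψ r * (Kk r x : ℂ))) (muT.prod nuI) := by
    refine (integrable_prod_iff hmeas.aestronglyMeasurable).mpr ⟨Eventually.of_forall fun x => (TT_int hm hM x).const_mul (g x), ?_⟩
    refine Integrable.of_bound (C := C * (M * (π / 2)))
      hmeas.norm.stronglyMeasurable.integral_prod_right'.aestronglyMeasurable
      (Eventually.of_forall fun x => ?_)
    simp only
    rw [Real.norm_of_nonneg (integral_nonneg fun _ => norm_nonneg _)]
    calc ∫ r, ‖g x * (ψ r * (Kk r x : ℂ))‖ ∂nuI ≤ ∫ r, (C * M) * |Kk r x| ∂nuI := by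
          refine integral_mono_ae ((TT_int hm hM x).const_mul (g x)).norm
            ((Kk_r x).1.abs.const_mul _) ?_
          filter_upwards [nuI_ae] with r hr
          rw [norm_mul, norm_mul, Complex.norm_real, Real.norm_eq_abs, ← mul_assoc]
          gcongr
          · exact hC x
          · exact hM r hr
      _ ≤ C * (M * (π / 2)) := by
          rw [integral_const_mul, mul_assoc]
          gcongr
          exact Kk_abs_int x
  have := integral_integral_swap hint
  unfold TT
  simp_rw [← integral_const_mul]
  rw [this]
  congr 1; ext r; congr 1; ext x; ring

lemma per_zero {f : ℝ → ℂ} (hp : Function.Periodic f (2 * π)) (h0 : f 0 = 0) (hπ : f π = 0)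
    {x : ℝ} (hx : Real.sin x = 0) : f x = 0 := by
  obtain ⟨n, rfl⟩ := Real.sin_eq_zero_iff.mp hx
  rcases Int.even_or_odd' n with ⟨k, rfl | rfl⟩
  · have := hp.int_mul k 0
    rw [zero_add] at this
    rw [← h0, ← this]; congr 1; push_cast; ring
  · have := hp.int_mul k π
    rw [← hπ, ← this]; congr 1; push_cast; ring

lemma flip_int {f : ℝ → ℂ} (hp : Function.Periodic f (2 * π)) :
    ∫ x, f (-x) ∂muT = ∫ x, f x ∂muT := by
  unfold muT
  rw [← intervalIntegral.integral_of_le (by positivity),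
    ← intervalIntegral.integral_of_le (by positivity), intervalIntegral.integral_comp_neg]
  have := hp.intervalIntegral_add_eq (-(2 * π)) 0
  simpa using this

lemma coef_eq (f : ℝ → ℂ) (n : ℕ) : fourierCoef f (-((n : ℤ) + 1))
    = (1 / (2 * π)) * ∫ x, f x * zz x ^ (n + 1) ∂muT := by
  unfold fourierCoef muT
  rw [intervalIntegral.integral_of_le (by positivity)]
  congr 2; ext x; congr 1
  unfold zz
  rw [← Complex.exp_nat_mul]; congr 1; push_cast; ring

lemma Hinf_int {h : ℝ → ℂ} (hh : h ∈ HinfT) (n : ℕ) : ∫ x, h x * zz x ^ (n + 1) ∂muT = 0 := by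
  have := hh.2 (-((n : ℤ) + 1)) (by omega)
  rw [coef_eq] at this
  have hp : (1 / (2 * π) : ℂ) ≠ 0 := by
    simp [Real.pi_ne_zero]
  exact (mul_eq_zero.mp this).resolve_left hp

lemma mem_Hinf {h : ℝ → ℂ} (hL : h ∈ LinfT) (hi : ∀ n : ℕ, ∫ x, h x * zz x ^ (n + 1) ∂muT = 0) :
    h ∈ HinfT := by
  refine ⟨hL, fun n hn => ?_⟩
  obtain ⟨k, rfl⟩ : ∃ k : ℕ, n = -((k : ℤ) + 1) := ⟨(-n - 1).toNat, by omega⟩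
  rw [coef_eq, hi, mul_zero]

lemma sin_bound {v : ℝ → ℂ} (hc : Continuous v) (hz : ∀ x, Real.sin x = 0 → v x = 0) {C : ℝ}
    (hC : ∀ x, ‖v x‖ ≤ C) {ε : ℝ} (hε : 0 < ε) :
    ∃ B : ℝ, 0 ≤ B ∧ ∀ x ∈ Set.Ioc 0 (2 * π), ‖v x‖ ≤ ε + B * Real.sin x ^ 2 := by
  have hC0 : 0 ≤ C := (norm_nonneg _).trans (hC 0)
  set S : Set ℝ := Set.Icc 0 (2 * π) ∩ {x | ε ≤ ‖v x‖} with hS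
  have hSc : IsCompact S := isCompact_Icc.inter_right (isClosed_le continuous_const hc.norm)
  rcases S.eq_empty_or_nonempty with he | hne
  · refine ⟨0, le_rfl, fun x hx => ?_⟩
    by_contra hcon
    have hle : ε ≤ ‖v x‖ := by linarith
    have : x ∈ S := ⟨⟨hx.1.le, hx.2⟩, hle⟩
    rw [he] at this; exact this
  · obtain ⟨y, hy, hmin⟩ := hSc.exists_isMinOn hne
      (f := fun x => Real.sin x ^ 2) (by fun_prop)
    have hpos : 0 < Real.sin y ^ 2 := by
      have : Real.sin y ≠ 0 := by
        intro h
        have h2 : ε ≤ ‖v y‖ := hy.2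
        rw [hz y h, norm_zero] at h2; linarith
      positivity
    refine ⟨C / Real.sin y ^ 2, by positivity, fun x hx => ?_⟩
    by_cases h : ε ≤ ‖v x‖
    · have h3 : Real.sin y ^ 2 ≤ Real.sin x ^ 2 := hmin (show x ∈ S from ⟨⟨hx.1.le, hx.2⟩, h⟩)
      have : C ≤ C / Real.sin y ^ 2 * Real.sin x ^ 2 := by
        rw [div_mul_eq_mul_div, le_div_iff₀ hpos]; gcongr
      linarith [hC x]
    · have : 0 ≤ C / Real.sin y ^ 2 * Real.sin x ^ 2 := by positivity
      linarith

lemma sin_Pk {r : ℝ} (hr : |r| < 1) (x : ℝ) : Real.sin x ^ 2 * Pk r x ≤ 1 - r ^ 2 := by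
  have hD := Dk_pos hr x
  have h2 : r ^ 2 ≤ 1 := by rw [← sq_abs]; nlinarith [abs_nonneg r]
  unfold Pk
  rw [← mul_div_assoc, div_le_iff₀ hD, mul_comm]
  have : Real.sin x ^ 2 ≤ Dk r x := by rw [Dk_eq]; nlinarith [sq_nonneg (r - Real.cos x)]
  exact mul_le_mul_of_nonneg_left this (by linarith)

lemma Pk_int {r : ℝ} (hr : |r| < 1) : Integrable (Pk r) muT :=
  Integrable.of_bound (Pk_cont hr).measurable.aestronglyMeasurable _
    (Eventually.of_forall fun x => Pk_bound hr x)

lemma sg_meas : Measurable sg := by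
  unfold sg Real.sign
  refine Measurable.ite (measurableSet_lt (by fun_prop) measurable_const) measurable_const ?_
  exact Measurable.ite (measurableSet_lt measurable_const (by fun_prop)) measurable_const
    measurable_const

lemma sg_per : Function.Periodic sg (2 * π) := by
  intro x; unfold sg; rw [Real.sin_add_two_pi]

/-- Poisson integral on the diameter. -/
def phi (h : ℝ → ℂ) (r : ℝ) : ℂ := (1 / (2 * π)) * ∫ x, h x * (Pk r x : ℂ) ∂muT

lemma phi_meas {h : ℝ → ℂ} (hm : Measurable h) : Measurable (phi h) := by
  have : Measurable (fun p : ℝ × ℝ => h p.2 * (Pk p.1 p.2 : ℂ)) := by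
    have h2 : Measurable (fun p : ℝ × ℝ => (Pk p.1 p.2 : ℂ)) := by unfold Pk Dk; fun_prop
    exact (hm.comp measurable_snd).mul h2
  exact this.stronglyMeasurable.integral_prod_right'.measurable.const_mul _

lemma phi_bound {h : ℝ → ℂ} {ε B : ℝ} (hB : 0 ≤ B)
    (hb : ∀ x ∈ Set.Ioc 0 (2 * π), ‖h x‖ ≤ ε + B * Real.sin x ^ 2) {r : ℝ} (hr : |r| < 1) :
    ‖phi h r‖ ≤ ε + B * (1 - r ^ 2) := by
  unfold phi
  have h1 : ‖∫ x, h x * (Pk r x : ℂ) ∂muT‖ ≤ ∫ x, (ε * Pk r x + B * (1 - r ^ 2)) ∂muT := by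
    refine norm_integral_le_of_norm_le (((Pk_int hr).const_mul _).add (integrable_const _)) ?_
    unfold muT
    filter_upwards [ae_restrict_mem measurableSet_Ioc] with x hx
    rw [norm_mul, Complex.norm_real, Real.norm_of_nonneg (Pk_nonneg hr x)]
    have a := mul_le_mul_of_nonneg_right (hb x hx) (Pk_nonneg hr x)
    have b := mul_le_mul_of_nonneg_left (sin_Pk hr x) hB
    linarith
  rw [integral_add ((Pk_int hr).const_mul _) (integrable_const _), integral_const_mul,
    int_Pk hr] at h1
  have h2 : ∫ _x, B * (1 - r ^ 2) ∂muT = 2 * π * (B * (1 - r ^ 2)) := by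
    simp [muT, Real.pi_pos.le]
  rw [h2] at h1
  have h3 : ‖(1 / (2 * π) : ℂ)‖ = 1 / (2 * π) := by
    simp [abs_of_pos Real.pi_pos]
  rw [norm_mul, h3]
  have hpi := Real.pi_pos
  rw [one_div, inv_mul_le_iff₀ (by positivity)]
  linarith

lemma phi_flip {h : ℝ → ℂ} (hp : Function.Periodic h (2 * π)) (r : ℝ) :
    phi (flipF h) r = phi h r := by
  unfold phi flipF
  congr 1
  have hper : Function.Periodic (fun x => h x * (Pk r x : ℂ)) (2 * π) := by
    intro x
    simp only [hp x, Pk, Dk, Real.cos_add_two_pi]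
  rw [← flip_int hper]
  congr 1; ext x
  simp only [Pk, Dk, Real.cos_neg]

lemma phi_even {h : ℝ → ℂ} (hh : h ∈ LinfT) {r : ℝ} (hr : |r| < 1) :
    phi (fun x => (h x + h (-x)) / 2) r = phi h r := by
  obtain ⟨hp, hm, C, hC⟩ := hh
  have hPi : ∀ g : ℝ → ℂ, Measurable g → (∀ x, ‖g x‖ ≤ C) →
      Integrable (fun x => g x * (Pk r x : ℂ)) muT := by
    intro g gm gC
    refine mul_int gm gC (B := 1 / (1 - |r|) ^ 2) ?_ ?_
    · exact (Complex.continuous_ofReal.comp (Pk_cont hr)).measurable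
    · intro x
      rw [Complex.norm_real]
      exact Pk_bound hr x
  have e : phi (fun x => (h x + h (-x)) / 2) r = (phi h r + phi (flipF h) r) / 2 := by
    unfold phi flipF
    rw [← mul_add, ← integral_add (hPi h hm hC)
      (hPi (fun x => h (-x)) (hm.comp measurable_neg) (fun x => hC _)), mul_div_assoc,
      ← integral_div]
    congr 2; ext x; ring
  rw [e, phi_flip hp]; ring

lemma core {h : ℝ → ℂ} (hh : h ∈ HinfT) (hc : Continuous (fun x => h x + h (-x)))
    (h0 : h 0 = 0) (hπ : h π = 0) :
    ∃ W ∈ CtsT, (fun x => (sg x : ℂ) * h x) - W ∈ HinfT := by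
  obtain ⟨hp, hm, C, hC⟩ := hh.1
  have hC0 : 0 ≤ C := (norm_nonneg _).trans (hC 0)
  have hM : ∀ r, |r| < 1 → ‖phi h r‖ ≤ C := by
    intro r hr
    have := phi_bound (h := h) (ε := C) (B := 0) le_rfl (fun x _ => by simpa using hC x) hr
    simpa using this
  have hv : ∀ ε > 0, ∃ ρ < 1, ∀ r, ρ < |r| → |r| < 1 → ‖phi h r‖ ≤ ε := by
    intro ε hε
    obtain ⟨B, hB, hb⟩ := sin_bound (v := fun x => (h x + h (-x)) / 2) (hc.div_const 2) (by
      intro x hx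
      rw [per_zero hp h0 hπ hx, per_zero hp h0 hπ (x := -x) (by rw [Real.sin_neg, hx, neg_zero])]
      simp) (C := C) (by
      intro x
      rw [norm_div]
      have := norm_add_le (h x) (h (-x))
      have a := hC x
      have b := hC (-x)
      simp only [Complex.norm_ofNat]
      linarith) (half_pos hε)
    refine ⟨1 - ε / (4 * (B + 1)), by have : 0 < ε / (4 * (B + 1)) := by positivity
                                      linarith, fun r hr1 hr => ?_⟩
    rw [← phi_even hh.1 hr]
    refine (phi_bound hB hb hr).trans ?_
    have h1 : 1 - |r| < ε / (4 * (B + 1)) := by linarith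
    rw [lt_div_iff₀ (by positivity)] at h1
    have h2 : 1 - r ^ 2 ≤ 2 * (1 - |r|) := by rw [← sq_abs]; nlinarith [sq_nonneg (1 - |r|)]
    have h3 := mul_le_mul_of_nonneg_left h2 hB
    nlinarith
  have hcont := TT_cont (phi_meas hm) hM hv
  have hKper : ∀ r x, Kk r (x + 2 * π) = Kk r x := by
    intro r x; simp only [Kk, Dk, Real.cos_add_two_pi, Real.sin_add_two_pi]
  have hWp : Function.Periodic (fun x => (2 / π : ℂ) * TT (phi h) x) (2 * π) := by
    intro x; simp only [TT, hKper]
  have hsm : Measurable (fun x => (sg x : ℂ) * h x) :=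
    (Complex.measurable_ofReal.comp sg_meas).mul hm
  have hsb : ∀ x, ‖(sg x : ℂ) * h x‖ ≤ C := by
    intro x
    rw [norm_mul, Complex.norm_real, Real.norm_eq_abs]
    calc |sg x| * ‖h x‖ ≤ 1 * C := mul_le_mul (sg_abs x) (hC x) (norm_nonneg _) zero_le_one
      _ = C := one_mul C
  have hWb : ∀ x, ‖(2 / π : ℂ) * TT (phi h) x‖ ≤ ‖(2 / π : ℂ)‖ * (C * (π / 2)) := by
    intro x
    rw [norm_mul]
    gcongr
    exact TT_bound hM x
  have hWm : Measurable (fun x => (2 / π : ℂ) * TT (phi h) x) := (hcont.measurable).const_mul _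
  refine ⟨fun x => (2 / π : ℂ) * TT (phi h) x, ⟨hWp, continuous_const.mul hcont⟩, ?_⟩
  refine mem_Hinf ⟨?_, hsm.sub hWm, C + ‖(2 / π : ℂ)‖ * (C * (π / 2)), fun x => ?_⟩ ?_
  · intro x
    have := hWp x
    simp only [Pi.sub_apply] at this ⊢
    rw [this, sg_per x, hp x]
  · exact (norm_sub_le _ _).trans (add_le_add (hsb x) (hWb x))
  · intro n
    have zm : Measurable (fun x => zz x ^ (n + 1)) := (zz_cont.pow _).measurable
    have zb : ∀ x, ‖zz x ^ (n + 1)‖ ≤ 1 := fun x => by rw [norm_pow, zz_norm, one_pow]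
    have hpi : (π : ℂ) ≠ 0 := by exact_mod_cast Real.pi_ne_zero
    have T1 : ∀ x, TT (fun _ => 1) x = π / 2 * (sg x : ℂ) := by
      intro x
      unfold TT
      simp only [one_mul]
      rw [integral_complex_ofReal, (Kk_r x).2]; push_cast; rfl
    have F1 := fubini (ψ := fun _ => 1) measurable_const (M := 1) (by simp)
      (hm.mul zm) (C := C * 1) (fun x => by
        rw [Pi.mul_apply, norm_mul]; exact mul_le_mul (hC x) (zb x) (norm_nonneg _) hC0)
    have F2 := fubini (phi_meas hm) hM zm zb
    have F3 : ∫ x, (h * fun x => zz x ^ (n + 1)) x * TT (fun _ => 1) x ∂muT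
        = ∫ x, zz x ^ (n + 1) * TT (phi h) x ∂muT := by
      rw [F1, F2]
      refine integral_congr_ae ?_
      filter_upwards [nuI_ae] with r hr
      have k1 := key_id hm hC (Hinf_int hh) hr n
      have k2 := key_id (h := fun _ => 1) measurable_const (C := 1) (by simp) int_zz_pow hr n
      simp only [one_mul] at k2
      rw [integral_complex_ofReal, int_Pk hr] at k2
      rw [k2]
      simp only [Pi.mul_apply, mul_assoc, one_mul] at k1 ⊢
      rw [k1]
      unfold phi
      push_cast
      field_simp
    have e : ∫ x, ((fun x => (sg x : ℂ) * h x) - fun x => (2 / π : ℂ) * TT (phi h) x) x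
          * zz x ^ (n + 1) ∂muT
        = ∫ x, (2 / π : ℂ) * ((h * fun x => zz x ^ (n + 1)) x * TT (fun _ => 1) x) ∂muT
          - ∫ x, (2 / π : ℂ) * (zz x ^ (n + 1) * TT (phi h) x) ∂muT := by
      rw [← integral_sub]
      · congr 1; ext x
        simp only [Pi.sub_apply, Pi.mul_apply]
        rw [T1]
        field_simp
      · have := mul_int (μ := muT) hsm hsb zm zb
        refine this.congr (Eventually.of_forall fun x => ?_)
        simp only [Pi.mul_apply, T1]
        field_simp
      · have := mul_int (μ := muT) hWm hWb zm zb
        refine this.congr (Eventually.of_forall fun x => ?_)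
        simp only
        ring
    rw [e, integral_const_mul, integral_const_mul, F3, sub_self]

lemma Linf_add {f g : ℝ → ℂ} (hf : f ∈ LinfT) (hg : g ∈ LinfT) : f + g ∈ LinfT := by
  obtain ⟨p, m, C, hC⟩ := hf
  obtain ⟨p', m', C', hC'⟩ := hg
  exact ⟨p.add p', m.add m', C + C', fun x => (norm_add_le _ _).trans (add_le_add (hC x) (hC' x))⟩

lemma Linf_smul (c : ℂ) {f : ℝ → ℂ} (hf : f ∈ LinfT) : c • f ∈ LinfT := by
  obtain ⟨p, m, C, hC⟩ := hf
  refine ⟨fun x => by simp [p x], m.const_smul c, ‖c‖ * C, fun x => ?_⟩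
  rw [Pi.smul_apply, norm_smul]
  exact mul_le_mul_of_nonneg_left (hC x) (norm_nonneg c)

lemma per_flip {f : ℝ → ℂ} (p : Function.Periodic f (2 * π)) :
    Function.Periodic (flipF f) (2 * π) := by
  intro x
  unfold flipF
  rw [neg_add, ← sub_eq_add_neg, p.sub_eq]

lemma Linf_flip {f : ℝ → ℂ} (hf : f ∈ LinfT) : flipF f ∈ LinfT := by
  obtain ⟨p, m, C, hC⟩ := hf
  exact ⟨per_flip p, m.comp measurable_neg, C, fun x => hC _⟩

/-- Exponential with integer frequency. -/
def ee (n : ℤ) (x : ℝ) : ℂ := Complex.exp (-(Complex.I * n * x))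

lemma ee_cont (n : ℤ) : Continuous (ee n) := by unfold ee; fun_prop

lemma ee_norm (n : ℤ) (x : ℝ) : ‖ee n x‖ ≤ 1 := by
  have : -(Complex.I * n * x) = ((-(n * x) : ℝ) : ℂ) * Complex.I := by push_cast; ring
  unfold ee
  rw [this, Complex.norm_exp_ofReal_mul_I]

lemma ee_per (n : ℤ) : Function.Periodic (ee n) (2 * π) := by
  intro x
  unfold ee
  rw [Complex.exp_eq_exp_iff_exists_int]
  exact ⟨-n, by push_cast; ring⟩

lemma coef_mu (f : ℝ → ℂ) (n : ℤ) :
    fourierCoef f n = (1 / (2 * π)) * ∫ x, f x * ee n x ∂muT := by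
  unfold fourierCoef muT
  rw [intervalIntegral.integral_of_le (by positivity)]
  rfl

lemma coef_add {f g : ℝ → ℂ} (hf : f ∈ LinfT) (hg : g ∈ LinfT) (n : ℤ) :
    fourierCoef (f + g) n = fourierCoef f n + fourierCoef g n := by
  obtain ⟨p, m, C, hC⟩ := hf
  obtain ⟨p', m', C', hC'⟩ := hg
  simp only [coef_mu]
  rw [← mul_add, ← integral_add (mul_int m hC (ee_cont n).measurable (ee_norm n))
    (mul_int m' hC' (ee_cont n).measurable (ee_norm n))]
  congr 2; ext x; rw [Pi.add_apply, add_mul]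

lemma coef_smul (c : ℂ) (f : ℝ → ℂ) (n : ℤ) :
    fourierCoef (c • f) n = c * fourierCoef f n := by
  simp only [coef_mu, Pi.smul_apply, smul_eq_mul, mul_assoc]
  rw [integral_const_mul]; ring

lemma coef_flip {f : ℝ → ℂ} (p : Function.Periodic f (2 * π)) (n : ℤ) :
    fourierCoef (flipF f) n = fourierCoef f (-n) := by
  simp only [coef_mu]
  rw [← flip_int (f := fun x => f x * ee (-n) x) (p.mul (ee_per _))]
  congr 2; ext x
  simp [flipF, ee]

lemma Hinf_add {f g : ℝ → ℂ} (hf : f ∈ HinfT) (hg : g ∈ HinfT) : f + g ∈ HinfT :=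
  ⟨Linf_add hf.1 hg.1, fun n hn => by rw [coef_add hf.1 hg.1, hf.2 n hn, hg.2 n hn, add_zero]⟩

lemma HinfBar_add {f g : ℝ → ℂ} (hf : f ∈ HinfBarT) (hg : g ∈ HinfBarT) : f + g ∈ HinfBarT :=
  ⟨Linf_add hf.1 hg.1, fun n hn => by rw [coef_add hf.1 hg.1, hf.2 n hn, hg.2 n hn, add_zero]⟩

lemma Hinf_smul (c : ℂ) {f : ℝ → ℂ} (hf : f ∈ HinfT) : c • f ∈ HinfT :=
  ⟨Linf_smul c hf.1, fun n hn => by rw [coef_smul, hf.2 n hn, mul_zero]⟩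

lemma HinfBar_smul (c : ℂ) {f : ℝ → ℂ} (hf : f ∈ HinfBarT) : c • f ∈ HinfBarT :=
  ⟨Linf_smul c hf.1, fun n hn => by rw [coef_smul, hf.2 n hn, mul_zero]⟩

lemma Hinf_flip {f : ℝ → ℂ} (hf : f ∈ HinfT) : flipF f ∈ HinfBarT :=
  ⟨Linf_flip hf.1, fun n hn => by rw [coef_flip hf.1.1, hf.2 (-n) (by omega)]⟩

lemma HinfBar_flip {f : ℝ → ℂ} (hf : f ∈ HinfBarT) : flipF f ∈ HinfT :=
  ⟨Linf_flip hf.1, fun n hn => by rw [coef_flip hf.1.1, hf.2 (-n) (by omega)]⟩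

lemma Cts_add {f g : ℝ → ℂ} (hf : f ∈ CtsT) (hg : g ∈ CtsT) : f + g ∈ CtsT :=
  ⟨hf.1.add hg.1, hf.2.add hg.2⟩

lemma Cts_smul (c : ℂ) {f : ℝ → ℂ} (hf : f ∈ CtsT) : c • f ∈ CtsT :=
  ⟨fun x => by simp [hf.1 x], hf.2.const_smul c⟩

lemma Cts_flip {f : ℝ → ℂ} (hf : f ∈ CtsT) : flipF f ∈ CtsT :=
  ⟨per_flip hf.1, hf.2.comp continuous_neg⟩

lemma QC_add {f g : ℝ → ℂ} (hf : f ∈ QCset) (hg : g ∈ QCset) : f + g ∈ QCset := by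
  obtain ⟨⟨c, hc, h, hh, e⟩, ⟨c', hc', h', hh', e'⟩⟩ := hf
  obtain ⟨⟨d, hd, k, hk, i⟩, ⟨d', hd', k', hk', i'⟩⟩ := hg
  refine ⟨⟨c + d, Cts_add hc hd, h + k, Hinf_add hh hk, ?_⟩,
    ⟨c' + d', Cts_add hc' hd', h' + k', HinfBar_add hh' hk', ?_⟩⟩
  · rw [e, i]; abel
  · rw [e', i']; abel

lemma QC_smul (a : ℂ) {f : ℝ → ℂ} (hf : f ∈ QCset) : a • f ∈ QCset := by
  obtain ⟨⟨c, hc, h, hh, e⟩, ⟨c', hc', h', hh', e'⟩⟩ := hf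
  refine ⟨⟨a • c, Cts_smul a hc, a • h, Hinf_smul a hh, ?_⟩,
    ⟨a • c', Cts_smul a hc', a • h', HinfBar_smul a hh', ?_⟩⟩
  · rw [e, smul_add]
  · rw [e', smul_add]

lemma QC_flip {f : ℝ → ℂ} (hf : f ∈ QCset) : flipF f ∈ QCset := by
  obtain ⟨⟨c, hc, h, hh, e⟩, ⟨c', hc', h', hh', e'⟩⟩ := hf
  refine ⟨⟨flipF c', Cts_flip hc', flipF h', HinfBar_flip hh', ?_⟩,
    ⟨flipF c, Cts_flip hc, flipF h, Hinf_flip hh, ?_⟩⟩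
  · rw [e']; rfl
  · rw [e]; rfl

lemma zz_Hinf : zz ∈ HinfT := by
  refine mem_Hinf ⟨zz_per, zz_cont.measurable, 1, fun x => (zz_norm x).le⟩ fun n => ?_
  have := int_zz_pow (n + 1)
  rw [← this]; congr 1; ext x; ring

lemma one_Hinf : (1 : ℝ → ℂ) ∈ HinfT :=
  mem_Hinf ⟨fun x => rfl, measurable_const, 1, fun x => by simp⟩ int_zz_pow

lemma sg_mul_cont {f : ℝ → ℂ} (hf : Continuous f) (hz : ∀ x, Real.sin x = 0 → f x = 0) :
    Continuous (fun x => (sg x : ℂ) * f x) := by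
  rw [continuous_iff_continuousAt]
  intro x
  rcases lt_trichotomy (Real.sin x) 0 with h | h | h
  · have : ∀ᶠ y in 𝓝 x, -f y = (sg y : ℂ) * f y := by
      filter_upwards [Real.continuous_sin.continuousAt.eventually_lt_const h] with y hy
      simp [sg, Real.sign_of_neg hy]
    exact hf.neg.continuousAt.congr this
  · have h1 : (sg x : ℂ) * f x = 0 := by rw [hz x h, mul_zero]
    unfold ContinuousAt
    beta_reduce
    rw [h1]
    have h2 : Tendsto (fun y => ‖f y‖) (𝓝 x) (𝓝 0) := by
      have := hf.norm.tendsto x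
      rwa [hz x h, norm_zero] at this
    refine squeeze_zero_norm (fun y => ?_) h2
    rw [norm_mul, Complex.norm_real, Real.norm_eq_abs]
    exact mul_le_of_le_one_left (norm_nonneg _) (sg_abs y)
  · have : ∀ᶠ y in 𝓝 x, f y = (sg y : ℂ) * f y := by
      filter_upwards [Real.continuous_sin.continuousAt.eventually_const_lt h] with y hy
      simp [sg, Real.sign_of_pos hy]
    exact hf.continuousAt.congr this

lemma main_QC {q : ℝ → ℂ} (hq : q ∈ QCset) (ho : ∀ x, q (-x) = - q x) :
    (fun x => (sg x : ℂ) * q x) ∈ QCset := by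
  obtain ⟨⟨c, hc, h, hh, e⟩, -⟩ := hq
  have ex : ∀ x, q x = c x + h x := fun x => by rw [e]; rfl
  have z0 : zz 0 = 1 := by simp [zz_eq]
  have zp : zz π = -1 := by simp [zz_eq]
  have hqp : Function.Periodic q (2 * π) := by rw [e]; exact hc.1.add hh.1.1
  have q0 : q 0 = 0 := by
    have := ho 0
    rw [neg_zero] at this
    exact self_eq_neg.mp this
  have qp : q π = 0 := by
    have h1 := ho π
    have h2 := hqp (-π)
    rw [show -π + 2 * π = π by ring, h1] at h2
    exact self_eq_neg.mp h2
  set a : ℂ := (h 0 + h π) / 2 with ha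
  set b : ℂ := (h 0 - h π) / 2 with hb
  set h1 : ℝ → ℂ := h + ((-a) • (1 : ℝ → ℂ) + (-b) • zz) with hh1
  have h1x : ∀ x, h1 x = h x - a - b * zz x := by
    intro x; simp [hh1]; ring
  have h1H : h1 ∈ HinfT := Hinf_add hh (Hinf_add (Hinf_smul _ one_Hinf) (Hinf_smul _ zz_Hinf))
  have h10 : h1 0 = 0 := by rw [h1x, z0, ha, hb]; ring
  have h1p : h1 π = 0 := by rw [h1x, zp, ha, hb]; ring
  have h1c : Continuous (fun x => h1 x + h1 (-x)) := by
    have e2 : (fun x => h1 x + h1 (-x))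
        = fun x => -(c x + c (-x)) - 2 * a - b * (zz x + zz (-x)) := by
      ext x
      rw [h1x, h1x]
      have := ho x
      rw [ex, ex] at this
      linear_combination this
    rw [e2]
    have := hc.2
    have := zz_cont
    fun_prop
  obtain ⟨W, hW, hg⟩ := core h1H h1c h10 h1p
  set g := (fun x => (sg x : ℂ) * h1 x) - W with hgdef
  have kx : ∀ x, q x - h1 x = c x + a + b * zz x := by
    intro x; rw [h1x, ex]; ring
  have kc : Continuous (fun x => q x - h1 x) := by
    simp_rw [kx]
    have := hc.2
    have := zz_cont
    fun_prop
  have skc : Continuous (fun x => (sg x : ℂ) * (q x - h1 x)) := by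
    refine sg_mul_cont kc fun x hx => ?_
    rw [per_zero hqp q0 qp hx, per_zero h1H.1.1 h10 h1p hx, sub_zero]
  have skC : (fun x => (sg x : ℂ) * (q x - h1 x)) ∈ CtsT :=
    ⟨fun x => by simp only [sg_per x, hqp x, h1H.1.1 x], skc⟩
  have dec : (fun x => (sg x : ℂ) * q x) = ((fun x => (sg x : ℂ) * (q x - h1 x)) + W) + g := by
    ext x
    simp only [hgdef, Pi.add_apply, Pi.sub_apply]
    ring
  have hev : flipF (fun x => (sg x : ℂ) * q x) = fun x => (sg x : ℂ) * q x := by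
    ext x
    simp only [flipF, sg_neg, ho]
    push_cast; ring
  refine ⟨⟨_, Cts_add skC hW, g, hg, dec⟩, ⟨_, Cts_flip (Cts_add skC hW), _, Hinf_flip hg, ?_⟩⟩
  rw [← hev, dec]; rfl

lemma limsup_zero {f : ℝ → ℂ} {θ : ℝ} (h : ∀ᶠ x in 𝓝[>] θ, f x = 0) :
    Filter.limsup (fun x => ‖f x‖) (𝓝[>] θ) = 0 := by
  have : (fun x => ‖f x‖) =ᶠ[𝓝[>] θ] fun _ => (0 : ℝ) := by
    filter_upwards [h] with x hx
    rw [hx, norm_zero]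
  rw [Filter.limsup_congr this, Filter.limsup_const]

lemma ker_odd {θ : ℝ} (hθ : θ = 0 ∨ θ = π) {q : ℝ → ℂ} (hq : q ∈ QCset)
    (ho : ∀ x, q (-x) = - q x) :
    ∃ t ∈ tQCset, ∀ ξ, InMplus θ ξ → ξ q = ξ t := by
  have hs := main_QC hq ho
  have hev : flipF (fun x => (sg x : ℂ) * q x) = fun x => (sg x : ℂ) * q x := by
    ext x
    simp only [flipF, sg_neg, ho]
    push_cast; ring
  have gen : ∀ a : ℂ, (∀ᶠ x in 𝓝[>] θ, a * (sg x : ℂ) = 1) →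
      ∃ t ∈ tQCset, ∀ ξ, InMplus θ ξ → ξ q = ξ t := by
    intro a haa
    have ht : a • (fun x => (sg x : ℂ) * q x) ∈ QCset := QC_smul a hs
    refine ⟨_, ⟨ht, ?_⟩, fun ξ hξ => ?_⟩
    · have : flipF (a • fun x => (sg x : ℂ) * q x) = a • flipF (fun x => (sg x : ℂ) * q x) := rfl
      rw [this, hev]
    · set t := a • (fun x => (sg x : ℂ) * q x)
      have hd : q + (-1 : ℂ) • t ∈ QCset := QC_add hq (QC_smul _ ht)
      have h0 : ξ (q + (-1 : ℂ) • t) = 0 := by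
        refine hξ.2 _ hd (limsup_zero ?_)
        filter_upwards [haa] with x hx
        simp only [t, Pi.add_apply, Pi.smul_apply, smul_eq_mul]
        linear_combination (-q x) * hx
      rw [hξ.1.1 _ hq _ (QC_smul _ ht), hξ.1.2.2.1 _ _ ht] at h0
      linear_combination h0
  rcases hθ with rfl | rfl
  · refine gen 1 ?_
    filter_upwards [Ioo_mem_nhdsGT Real.pi_pos] with x hx
    simp [sg, Real.sign_of_pos (Real.sin_pos_of_mem_Ioo hx)]
  · refine gen (-1) ?_
    filter_upwards [Ioo_mem_nhdsGT (show π < 2 * π by linarith [Real.pi_pos])] with x hx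
    have : Real.sin x < 0 := by
      have := Real.sin_pos_of_mem_Ioo (x := x - π) ⟨by linarith [hx.1], by linarith [hx.2]⟩
      rw [Real.sin_sub_pi] at this
      linarith
    simp [sg, Real.sign_of_neg this]

/-- If `ξ₁, ξ₂ ∈ M_{±1}^+(QC)` (angle `θ = 0` for `τ = 1`, `θ = π` for `τ = -1`) agree on
the even quasicontinuous functions `Q̃C`, then `ξ₁ = ξ₂` (as characters of `QC`). -/
theorem Mplus_chars_agree (θ : ℝ) (hθ : θ = 0 ∨ θ = π)
    (ξ₁ ξ₂ : (ℝ → ℂ) → ℂ) (h₁ : InMplus θ ξ₁) (h₂ : InMplus θ ξ₂)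
    (hagree : ∀ q ∈ tQCset, ξ₁ q = ξ₂ q) :
    ∀ q ∈ QCset, ξ₁ q = ξ₂ q := by
  intro q hq
  have hf := QC_flip hq
  have he : (1 / 2 : ℂ) • (q + flipF q) ∈ QCset := QC_smul _ (QC_add hq hf)
  have ho : (1 / 2 : ℂ) • (q + (-1 : ℂ) • flipF q) ∈ QCset :=
    QC_smul _ (QC_add hq (QC_smul _ hf))
  have hte : (1 / 2 : ℂ) • (q + flipF q) ∈ tQCset := by
    refine ⟨he, ?_⟩
    ext x
    simp [flipF]
    ring
  obtain ⟨t, ht, hξ⟩ := ker_odd hθ ho (by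
    intro x
    simp [flipF]
    ring)
  have dec : q = (1 / 2 : ℂ) • (q + flipF q) + (1 / 2 : ℂ) • (q + (-1 : ℂ) • flipF q) := by
    ext x
    simp
    ring
  rw [dec, h₁.1.1 _ he _ ho, h₂.1.1 _ he _ ho, hξ _ h₁, hξ _ h₂, hagree _ hte, hagree _ ht]
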